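/- Every extreme point q of 𝒬 is rationalized by the indicator function 1_A of some up-set A ⊆ [0,1]^n; that is, there is an up-set A such that for each i = 1,…,n, q_i(t) = ∫_{[0,1]^{n−1}} 1_A(x) dx_{−i} at x_i = t for almost every t ∈ [0,1]. -/

import Mathlib

open MeasureTheory

noncomputable section

/-- The closed unit cube `[0,1]^n` in `ℝⁿ`. -/
def cube (n : ℕ) : Set (Fin n → ℝ) := Set.Icc 0 1

/-- `A` is an up-set of the cube `[0,1]^n`. -/
def UpSetIn (n : ℕ) (A : Set (Fin n → ℝ)) : Prop :=
  A ⊆ cube n ∧ ∀ x ∈ A, ∀ y ∈ cube n, x ≤ y → y ∈ A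

/-- `q : [0,1] → [0,1]` is nondecreasing and left-continuous. -/
def MonoLC (q : ℝ → ℝ) : Prop :=
  MonotoneOn q (Set.Icc 0 1) ∧
  (∀ t ∈ Set.Icc (0 : ℝ) 1, q t ∈ Set.Icc (0 : ℝ) 1) ∧
  ∀ t ∈ Set.Ioc (0 : ℝ) 1, Filter.Tendsto q (nhdsWithin t (Set.Iio t)) (nhds (q t))

/-- `f : [0,1]^n → [0,1]` rationalizes the tuple `q`: for each `i`, `q i` is (a.e.) the
one-dimensional marginal of `f` in dimension `i`.  Since the `i`-th coordinate of `x`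
is replaced by `t` and Lebesgue measure on the cube is a product probability measure,
`∫_{[0,1]^n} f (update x i t) dx` equals `∫_{[0,1]^{n-1}} f(x₋ᵢ ; t) dx₋ᵢ`. -/
def RationalizesN (n : ℕ) (f : (Fin n → ℝ) → ℝ) (q : Fin n → ℝ → ℝ) : Prop :=
  AEMeasurable f (volume.restrict (cube n)) ∧
  (∀ x ∈ cube n, f x ∈ Set.Icc (0 : ℝ) 1) ∧
  ∀ i, ∀ᵐ t ∂(volume.restrict (Set.Icc (0 : ℝ) 1)),
    q i t = ∫ x in cube n, f (Function.update x i t)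

/-- The set `𝒬` of rationalizable tuples of nondecreasing left-continuous functions. -/
def QsetN (n : ℕ) : Set (Fin n → ℝ → ℝ) :=
  {q | (∀ i, MonoLC (q i)) ∧ ∃ f, RationalizesN n f q}

/-- `q` is an extreme point of a set `S` of tuples of functions on `[0,1]`, with
componentwise convex combinations (only the values on `[0,1]` matter). -/
def ExtremePtQN (n : ℕ) (S : Set (Fin n → ℝ → ℝ)) (q : Fin n → ℝ → ℝ) : Prop :=
  q ∈ S ∧ ∀ q' ∈ S, ∀ q'' ∈ S, ∀ l : ℝ, 0 < l → l < 1 →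
    (∀ i, ∀ t ∈ Set.Icc (0 : ℝ) 1, q i t = l * q' i t + (1 - l) * q'' i t) →
    ∀ i, ∀ t ∈ Set.Icc (0 : ℝ) 1, q' i t = q'' i t

lemma cube_eq_pi (n : ℕ) : cube n = Set.univ.pi fun _ => Set.Icc (0 : ℝ) 1 :=
  (Set.pi_univ_Icc 0 1).symm

lemma mem_cube {n : ℕ} {x : Fin n → ℝ} : x ∈ cube n ↔ ∀ i, x i ∈ Set.Icc (0 : ℝ) 1 := by
  simp [cube, Set.mem_Icc, Pi.le_def, forall_and]

lemma measurableSet_cube (n : ℕ) : MeasurableSet (cube n) := measurableSet_Icc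

lemma volume_restrict_cube (n : ℕ) : (volume : Measure (Fin n → ℝ)).restrict (cube n) =
    Measure.pi fun _ => (volume : Measure ℝ).restrict (Set.Icc 0 1) := by
  rw [cube_eq_pi, volume_pi, Measure.restrict_pi_pi]

instance isProbabilityMeasure_unitInterval :
    IsProbabilityMeasure ((volume : Measure ℝ).restrict (Set.Icc 0 1)) :=
  ⟨by simp⟩

instance isProbabilityMeasure_cube (n : ℕ) :
    IsProbabilityMeasure ((volume : Measure (Fin n → ℝ)).restrict (cube n)) := by
  rw [volume_restrict_cube]; infer_instance

lemma volume_cube_ne_top (n : ℕ) : (volume : Measure (Fin n → ℝ)) (cube n) ≠ ⊤ := by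
  have h := measure_ne_top ((volume : Measure (Fin n → ℝ)).restrict (cube n)) Set.univ
  rwa [Measure.restrict_apply_univ] at h

lemma update_mem_cube {n : ℕ} {x : Fin n → ℝ} (hx : x ∈ cube n) (i : Fin n) {t : ℝ}
    (ht : t ∈ Set.Icc (0 : ℝ) 1) : Function.update x i t ∈ cube n := by
  rw [mem_cube] at hx ⊢
  intro j
  by_cases h : j = i
  · subst h; simpa using ht
  · simpa [h] using hx j

lemma measurable_update_prod {n : ℕ} (i : Fin n) :
    Measurable fun p : ℝ × (Fin n → ℝ) => Function.update p.2 i p.1 := by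
  refine measurable_pi_lambda _ fun j => ?_
  by_cases h : j = i
  · subst h; simpa using measurable_fst
  · simp only [Function.update_of_ne h]
    exact (measurable_pi_apply j).comp measurable_snd

/-- Resampling one coordinate of a uniform point of the cube gives a uniform point. -/
lemma measurePreserving_update {n : ℕ} (i : Fin n) :
    MeasurePreserving (fun p : ℝ × (Fin n → ℝ) => Function.update p.2 i p.1)
      (((volume : Measure ℝ).restrict (Set.Icc 0 1)).prod (volume.restrict (cube n)))
      (volume.restrict (cube n)) := by
  refine ⟨measurable_update_prod i, ?_⟩
  conv_rhs => rw [volume_restrict_cube]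
  refine (Measure.pi_eq fun s hs => ?_).symm
  rw [Measure.map_apply (measurable_update_prod i) (MeasurableSet.univ_pi hs)]
  have h : (fun p : ℝ × (Fin n → ℝ) => Function.update p.2 i p.1) ⁻¹' Set.univ.pi s =
      s i ×ˢ Set.univ.pi (Function.update s i Set.univ) := by
    ext p
    simp only [Set.mem_preimage, Set.mem_univ_pi, Set.mem_prod]
    constructor
    · intro h
      refine ⟨by simpa using h i, fun j => ?_⟩
      by_cases hj : j = i
      · subst hj; simp
      · simpa [hj] using h j
    · rintro ⟨h1, h2⟩ j
      by_cases hj : j = i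
      · subst hj; simpa using h1
      · simpa [hj] using h2 j
  rw [h, Measure.prod_prod, volume_restrict_cube, Measure.pi_pi,
    ← Finset.mul_prod_erase Finset.univ (fun j => (volume.restrict (Set.Icc (0 : ℝ) 1)) (s j))
      (Finset.mem_univ i),
    ← Finset.mul_prod_erase Finset.univ _ (Finset.mem_univ i)]
  congr 1
  rw [Function.update_self, measure_univ, one_mul]
  refine Finset.prod_congr rfl fun j hj => ?_
  rw [Function.update_of_ne (Finset.ne_of_mem_erase hj)]

lemma ae_ae_update {n : ℕ} (i : Fin n) {p : (Fin n → ℝ) → Prop}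
    (h : ∀ᵐ x ∂(volume.restrict (cube n)), p x) :
    ∀ᵐ t ∂((volume : Measure ℝ).restrict (Set.Icc 0 1)),
      ∀ᵐ x ∂(volume.restrict (cube n)), p (Function.update x i t) :=
  Measure.ae_ae_of_ae_prod ((measurePreserving_update i).quasiMeasurePreserving.ae h)

lemma integral_cube_eq {n : ℕ} (i : Fin n) {f : (Fin n → ℝ) → ℝ}
    (hf : IntegrableOn f (cube n)) :
    ∫ x in cube n, f x =
      ∫ t in Set.Icc (0 : ℝ) 1, ∫ x in cube n, f (Function.update x i t) := by
  have hp := measurePreserving_update i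
  have h1 : ∫ x in cube n, f x = ∫ p, f (Function.update p.2 i p.1)
      ∂(((volume : Measure ℝ).restrict (Set.Icc 0 1)).prod (volume.restrict (cube n))) := by
    conv_lhs => rw [← hp.map_eq]
    refine integral_map hp.measurable.aemeasurable ?_
    rw [hp.map_eq]
    exact hf.aestronglyMeasurable
  rw [h1, integral_prod]
  exact hp.integrable_comp_of_integrable hf

lemma setIntegral_slab_eq {n : ℕ} (i : Fin n) {f : (Fin n → ℝ) → ℝ}
    (hf : IntegrableOn f (cube n)) {S : Set ℝ} (hS : MeasurableSet S) :
    ∫ x in {x | x i ∈ S} ∩ cube n, f x =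
      ∫ t in S ∩ Set.Icc (0 : ℝ) 1, ∫ x in cube n, f (Function.update x i t) := by
  have hE : MeasurableSet {x : Fin n → ℝ | x i ∈ S} := measurable_pi_apply i hS
  rw [← Measure.restrict_restrict hE, ← integral_indicator hE, integral_cube_eq i,
    ← Measure.restrict_restrict hS, ← integral_indicator hS]
  · congr 1
    ext t
    by_cases ht : t ∈ S <;> simp [Set.indicator, ht]
  · exact Integrable.indicator hf hE

lemma integrableOn_cube_of_bound {n : ℕ} {f : (Fin n → ℝ) → ℝ} (hf : Measurable f) (C : ℝ)
    (hC : ∀ x, |f x| ≤ C) : IntegrableOn f (cube n) :=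
  Integrable.of_bound hf.aestronglyMeasurable C (ae_of_all _ hC)

lemma measurable_update_const {n : ℕ} (i : Fin n) (t : ℝ) :
    Measurable fun x : Fin n → ℝ => Function.update x i t :=
  (measurable_update_prod i).comp measurable_prodMk_left

lemma measurable_marginal {n : ℕ} (i : Fin n) {f : (Fin n → ℝ) → ℝ} (hf : Measurable f) :
    Measurable fun t => ∫ x in cube n, f (Function.update x i t) := by
  have h : StronglyMeasurable
      (Function.uncurry fun (t : ℝ) (x : Fin n → ℝ) => f (Function.update x i t)) :=
    (hf.comp (measurable_update_prod i)).stronglyMeasurable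
  exact (h.integral_prod_right (ν := volume.restrict (cube n))).measurable

lemma marginal_mem_Icc {n : ℕ} (i : Fin n) {f : (Fin n → ℝ) → ℝ}
    (h0 : ∀ x, 0 ≤ f x) (h1 : ∀ x, f x ≤ 1) (t : ℝ) :
    ∫ x in cube n, f (Function.update x i t) ∈ Set.Icc (0 : ℝ) 1 := by
  refine ⟨integral_nonneg fun x => h0 _, ?_⟩
  have h := integral_mono_of_nonneg (μ := volume.restrict (cube n))
    (f := fun x => f (Function.update x i t)) (g := fun _ => (1 : ℝ))
    (ae_of_all _ fun x => h0 _) (integrable_const _) (ae_of_all _ fun x => h1 _)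
  simpa using h

/-- The left-continuous modification on `(0, ∞)` of a monotone function, with the value at `0`
equal to `r` times the right limit there. -/
def leftReg (m : ℝ → ℝ) (r t : ℝ) : ℝ :=
  if 0 < t then Function.leftLim m t else r * Function.rightLim m 0

lemma leftReg_of_pos (m : ℝ → ℝ) (r : ℝ) {t : ℝ} (ht : 0 < t) :
    leftReg m r t = Function.leftLim m t := if_pos ht

lemma leftReg_zero (m : ℝ → ℝ) (r : ℝ) : leftReg m r 0 = r * Function.rightLim m 0 :=
  if_neg (lt_irrefl _)

lemma monoLC_leftReg {m : ℝ → ℝ} (hm : Monotone m) (h01 : ∀ t, m t ∈ Set.Icc (0 : ℝ) 1)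
    {r : ℝ} (hr : r ∈ Set.Icc (0 : ℝ) 1) : MonoLC (leftReg m r) := by
  have hl : ∀ t, Function.leftLim m t ∈ Set.Icc (0 : ℝ) 1 := fun t =>
    ⟨(h01 (t - 1)).1.trans (hm.le_leftLim (by linarith)), (hm.leftLim_le le_rfl).trans (h01 t).2⟩
  have hr0 : Function.rightLim m 0 ∈ Set.Icc (0 : ℝ) 1 :=
    ⟨(h01 0).1.trans (hm.le_rightLim le_rfl), (hm.rightLim_le one_pos).trans (h01 1).2⟩
  refine ⟨?_, ?_, ?_⟩
  · intro s hs t ht hst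
    rcases hs.1.lt_or_eq with h | h
    · rw [leftReg_of_pos _ _ h, leftReg_of_pos _ _ (h.trans_le hst)]
      exact hm.leftLim hst
    · subst h
      rcases ht.1.lt_or_eq with h' | h'
      · rw [leftReg_of_pos _ _ h', leftReg_zero]
        exact (mul_le_of_le_one_left hr0.1 hr.2).trans (hm.rightLim_le_leftLim h')
      · subst h'; exact le_rfl
  · intro t ht
    rcases ht.1.lt_or_eq with h | h
    · rw [leftReg_of_pos _ _ h]; exact hl t
    · subst h
      rw [leftReg_zero]
      exact ⟨mul_nonneg hr.1 hr0.1, mul_le_one₀ hr.2 hr0.1 hr0.2⟩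
  · intro t ht
    rw [leftReg_of_pos _ _ ht.1]
    have h1 : Filter.Tendsto (Function.leftLim m) (nhdsWithin t (Set.Iio t))
        (nhds (Function.leftLim m t)) :=
      (continuousWithinAt_leftLim_Iic (hm.tendsto_leftLim t)).mono_left
        (nhdsWithin_mono _ Set.Iio_subset_Iic_self)
    refine h1.congr' ?_
    filter_upwards [Ioo_mem_nhdsLT ht.1] with s hs
    rw [leftReg_of_pos _ _ hs.1]

lemma leftReg_ae_eq {m : ℝ → ℝ} (hm : Monotone m) (r : ℝ) :
    ∀ᵐ t ∂((volume : Measure ℝ).restrict (Set.Icc 0 1)), leftReg m r t = m t := by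
  have h1 : ∀ᵐ t ∂(volume : Measure ℝ), ContinuousAt m t := by
    have := hm.countable_not_continuousAt.measure_zero volume
    exact this
  have h2 : ∀ᵐ t ∂(volume : Measure ℝ), t ≠ 0 := by simp [ae_iff]
  rw [ae_restrict_iff' measurableSet_Icc]
  filter_upwards [h1, h2] with t ht ht0 hI
  rw [leftReg_of_pos _ _ (lt_of_le_of_ne hI.1 ht0.symm)]
  exact hm.continuousWithinAt_Iio_iff_leftLim_eq.1 ht.continuousWithinAt

lemma exists_mem_Ioo_of_ae {p : ℝ → Prop}
    (h : ∀ᵐ t ∂((volume : Measure ℝ).restrict (Set.Icc 0 1)), p t) {a b : ℝ} (ha : 0 ≤ a)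
    (hab : a < b) (hb : b ≤ 1) : ∃ y ∈ Set.Ioo a b, p y := by
  by_contra! hc
  rw [ae_restrict_iff' measurableSet_Icc] at h
  have h0 : volume (Set.Ioo a b) = 0 := by
    refine measure_mono_null (fun y hy => ?_) h
    intro hy'
    exact hc y hy (hy' ⟨ha.trans hy.1.le, hy.2.le.trans hb⟩)
  rw [Real.volume_Ioo, ENNReal.ofReal_eq_zero] at h0
  linarith

lemma MonoLC.eq_leftLim_of_ae {q s : ℝ → ℝ} (hq : MonoLC q) (hs : Monotone s)
    (h : ∀ᵐ t ∂((volume : Measure ℝ).restrict (Set.Icc 0 1)), q t = s t) {t : ℝ}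
    (ht : t ∈ Set.Ioc (0 : ℝ) 1) : q t = Function.leftLim s t := by
  have hf : ∃ᶠ y in nhdsWithin t (Set.Iio t), q y = s y := by
    rw [(nhdsLT_basis t).frequently_iff]
    intro a ha
    obtain ⟨y, hy, hy'⟩ := exists_mem_Ioo_of_ae h (le_max_right a 0) (max_lt ha ht.1) ht.2
    exact ⟨y, ⟨(le_max_left _ _).trans_lt hy.1, hy.2⟩, hy'⟩
  exact tendsto_nhds_unique_of_frequently_eq (hq.2.2 t ht) (hs.tendsto_leftLim t) hf

lemma MonoLC.exists_eq_leftReg {q s : ℝ → ℝ} (hq : MonoLC q) (hs : Monotone s)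
    (h : ∀ᵐ t ∂((volume : Measure ℝ).restrict (Set.Icc 0 1)), q t = s t) :
    ∃ r ∈ Set.Icc (0 : ℝ) 1, ∀ t ∈ Set.Icc (0 : ℝ) 1, q t = leftReg s r t := by
  have h0 : (0 : ℝ) ∈ Set.Icc (0 : ℝ) 1 := ⟨le_rfl, zero_le_one⟩
  have hq0 := (hq.2.1 0 h0).1
  have hle : q 0 ≤ Function.rightLim s 0 := by
    have hf : ∃ᶠ y in nhdsWithin 0 (Set.Ioi 0), q 0 ≤ s y := by
      rw [(nhdsGT_basis (0 : ℝ)).frequently_iff]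
      intro b hb
      obtain ⟨y, hy, hy'⟩ := exists_mem_Ioo_of_ae h le_rfl (lt_min hb one_pos) (min_le_right b 1)
      refine ⟨y, ⟨hy.1, hy.2.trans_le (min_le_left _ _)⟩, ?_⟩
      rw [← hy']
      exact hq.1 h0 ⟨hy.1.le, (hy.2.trans_le (min_le_right _ _)).le⟩ hy.1.le
    exact ge_of_tendsto_of_frequently (hs.tendsto_rightLim 0) hf
  have key : q 0 = q 0 / Function.rightLim s 0 * Function.rightLim s 0 := by
    rcases (hq0.trans hle).lt_or_eq with hp | hp
    · field_simp
    · rw [← hp] at hle ⊢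
      simp [le_antisymm hle hq0]
  refine ⟨q 0 / Function.rightLim s 0, ⟨div_nonneg hq0 (hq0.trans hle),
    div_le_one_of_le₀ hle (hq0.trans hle)⟩, fun t ht => ?_⟩
  rcases ht.1.lt_or_eq with h' | h'
  · rw [leftReg_of_pos _ _ h']
    exact hq.eq_leftLim_of_ae hs h ⟨h', ht.2⟩
  · subst h'
    rw [leftReg_zero, ← key]

lemma leftReg_convex_comb {m₁ m₂ : ℝ → ℝ} (h₁ : Monotone m₁) (h₂ : Monotone m₂) (a b r t : ℝ) :
    leftReg (fun t => a * m₁ t + b * m₂ t) r t = a * leftReg m₁ r t + b * leftReg m₂ r t := by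
  unfold leftReg
  split_ifs with ht
  · exact leftLim_eq_of_tendsto
      (((h₁.tendsto_leftLim t).const_mul a).add ((h₂.tendsto_leftLim t).const_mul b))
  · rw [rightLim_eq_of_tendsto
      (((h₁.tendsto_rightLim 0).const_mul a).add ((h₂.tendsto_rightLim 0).const_mul b))]
    ring

lemma monotone_marginal {n : ℕ} (i : Fin n) {f : (Fin n → ℝ) → ℝ} (hf : Measurable f)
    (hm : Monotone f) (h0 : ∀ x, 0 ≤ f x) (h1 : ∀ x, f x ≤ 1) :
    Monotone fun t => ∫ x in cube n, f (Function.update x i t) := by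
  have hint : ∀ t, IntegrableOn (fun x => f (Function.update x i t)) (cube n) := fun t =>
    integrableOn_cube_of_bound (hf.comp (measurable_update_const i t)) 1
      fun x => abs_le.2 ⟨by linarith [h0 (Function.update x i t)], h1 _⟩
  intro s t hst
  exact integral_mono (hint s) (hint t) fun x => hm (Function.update_mono hst)

/-- Regularized marginals of a monotone function form a rationalizable tuple. -/
lemma leftReg_marginal_mem_QsetN {n : ℕ} {f : (Fin n → ℝ) → ℝ} (hf : Measurable f)
    (hm : Monotone f) (h0 : ∀ x, 0 ≤ f x) (h1 : ∀ x, f x ≤ 1) {r : Fin n → ℝ}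
    (hr : ∀ i, r i ∈ Set.Icc (0 : ℝ) 1) :
    (fun i => leftReg (fun t => ∫ x in cube n, f (Function.update x i t)) (r i)) ∈ QsetN n :=
  ⟨fun i => monoLC_leftReg (monotone_marginal i hf hm h0 h1) (marginal_mem_Icc i h0 h1) (hr i),
    f, hf.aemeasurable, fun x _ => ⟨h0 x, h1 x⟩,
    fun i => leftReg_ae_eq (monotone_marginal i hf hm h0 h1) (r i)⟩

lemma ExtremePtQN.ae_eq_truncation {n : ℕ} {q : Fin n → ℝ → ℝ} (hq : ExtremePtQN n (QsetN n) q)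
    {G : (Fin n → ℝ) → ℝ} (hG : Measurable G) (hm : Monotone G) (hr : RationalizesN n G q)
    (h0 : ∀ x, 0 ≤ G x) (h1 : ∀ x, G x ≤ 1) {a : ℝ} (ha0 : 0 < a) (ha1 : a < 1) (i : Fin n) :
    ∀ᵐ t ∂((volume : Measure ℝ).restrict (Set.Icc 0 1)),
      q i t = ∫ x in cube n, min (G (Function.update x i t)) a / a := by
  have ha1' : 0 < 1 - a := sub_pos.2 ha1
  set H₁ : (Fin n → ℝ) → ℝ := fun x => min (G x) a / a with hH₁
  set H₂ : (Fin n → ℝ) → ℝ := fun x => max (G x - a) 0 / (1 - a) with hH₂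
  have m₁ : Measurable H₁ := (hG.min measurable_const).div_const a
  have m₂ : Measurable H₂ := ((hG.sub_const a).max measurable_const).div_const _
  have mono₁ : Monotone H₁ := fun x y hxy =>
    div_le_div_of_nonneg_right (min_le_min_right _ (hm hxy)) ha0.le
  have mono₂ : Monotone H₂ := fun x y hxy =>
    div_le_div_of_nonneg_right (max_le_max_right _ (sub_le_sub_right (hm hxy) a)) ha1'.le
  have p₁ : ∀ x, 0 ≤ H₁ x := fun x => div_nonneg (le_min (h0 x) ha0.le) ha0.le
  have p₂ : ∀ x, 0 ≤ H₂ x := fun x => div_nonneg (le_max_right _ _) ha1'.le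
  have l₁ : ∀ x, H₁ x ≤ 1 := fun x => (div_le_one ha0).2 (min_le_right _ _)
  have l₂ : ∀ x, H₂ x ≤ 1 := fun x =>
    (div_le_one ha1').2 (max_le (sub_le_sub_right (h1 x) a) ha1'.le)
  have hsplit : ∀ x, G x = a * H₁ x + (1 - a) * H₂ x := by
    intro x
    simp only [hH₁, hH₂]
    rw [mul_div_cancel₀ _ ha0.ne', mul_div_cancel₀ _ ha1'.ne']
    rcases le_total (G x) a with h | h
    · rw [min_eq_left h, max_eq_right (by linarith)]; ring
    · rw [min_eq_right h, max_eq_left (by linarith)]; ring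
  have hint : ∀ {H : (Fin n → ℝ) → ℝ}, Measurable H → (∀ x, 0 ≤ H x) → (∀ x, H x ≤ 1) →
      ∀ (j : Fin n) t, IntegrableOn (fun x => H (Function.update x j t)) (cube n) :=
    fun {H} hH h0 h1 j t => integrableOn_cube_of_bound (hH.comp (measurable_update_const j t)) 1
      fun x => abs_le.2 ⟨by linarith [h0 (Function.update x j t)], h1 _⟩
  have hmarg : ∀ j t, ∫ x in cube n, G (Function.update x j t) =
      a * (∫ x in cube n, H₁ (Function.update x j t)) +
        (1 - a) * ∫ x in cube n, H₂ (Function.update x j t) := by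
    intro j t
    rw [← integral_const_mul, ← integral_const_mul, ← integral_add]
    · simp only [← hsplit]
    · exact (hint m₁ p₁ l₁ j t).const_mul a
    · exact (hint m₂ p₂ l₂ j t).const_mul (1 - a)
  choose r hr01 hreq using fun j =>
    (hq.1.1 j).exists_eq_leftReg (monotone_marginal j hG hm h0 h1) (hr.2.2 j)
  have hcomb : ∀ j, ∀ t ∈ Set.Icc (0 : ℝ) 1, q j t =
      a * leftReg (fun t => ∫ x in cube n, H₁ (Function.update x j t)) (r j) t +
        (1 - a) * leftReg (fun t => ∫ x in cube n, H₂ (Function.update x j t)) (r j) t := by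
    intro j t ht
    rw [hreq j t ht, ← leftReg_convex_comb (monotone_marginal j m₁ mono₁ p₁ l₁)
      (monotone_marginal j m₂ mono₂ p₂ l₂)]
    simp only [hmarg]
  have heq := hq.2 _ (leftReg_marginal_mem_QsetN m₁ mono₁ p₁ l₁ hr01) _
    (leftReg_marginal_mem_QsetN m₂ mono₂ p₂ l₂ hr01) a ha0 ha1 hcomb i
  filter_upwards [leftReg_ae_eq (monotone_marginal i m₁ mono₁ p₁ l₁) (r i),
    ae_restrict_mem measurableSet_Icc] with t ht htI
  rw [hcomb i t htI, ← heq t htI, ht]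
  ring

/-- An extreme point rationalized by a monotone function is rationalized by the up-set on which
this function is positive. -/
lemma ExtremePtQN.exists_upSetIn {n : ℕ} {q : Fin n → ℝ → ℝ} (hq : ExtremePtQN n (QsetN n) q)
    {G : (Fin n → ℝ) → ℝ} (hG : Measurable G) (hm : Monotone G) (hr : RationalizesN n G q)
    (h0 : ∀ x, 0 ≤ G x) (h1 : ∀ x, G x ≤ 1) :
    ∃ A : Set (Fin n → ℝ), UpSetIn n A ∧ RationalizesN n (A.indicator 1) q := by
  have hAm : MeasurableSet ({x | 0 < G x} ∩ cube n) :=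
    (measurableSet_lt measurable_const hG).inter (measurableSet_cube n)
  refine ⟨{x | 0 < G x} ∩ cube n, ⟨Set.inter_subset_right, fun x hx y hy hxy =>
    ⟨lt_of_lt_of_le hx.1 (hm hxy), hy⟩⟩, (measurable_one.indicator hAm).aemeasurable,
    fun x _ => ?_, fun i => ?_⟩
  · by_cases hx : x ∈ {x | 0 < G x} ∩ cube n <;> simp [hx]
  · have hk : ∀ᵐ t ∂((volume : Measure ℝ).restrict (Set.Icc 0 1)), ∀ k : ℕ, q i t =
        ∫ x in cube n, min (G (Function.update x i t)) (1 / ((k : ℝ) + 2)) / (1 / ((k : ℝ) + 2)) := by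
      rw [ae_all_iff]
      intro k
      refine hq.ae_eq_truncation hG hm hr h0 h1 (by positivity) ?_ i
      rw [div_lt_one (by positivity)]
      have : (0 : ℝ) ≤ k := k.cast_nonneg
      linarith
    filter_upwards [hk, ae_restrict_mem measurableSet_Icc] with t ht htI
    have hlim : Filter.Tendsto (fun k : ℕ => ∫ x in cube n,
        min (G (Function.update x i t)) (1 / ((k : ℝ) + 2)) / (1 / ((k : ℝ) + 2))) Filter.atTop
        (nhds (∫ x in cube n, ({x | 0 < G x} ∩ cube n).indicator 1 (Function.update x i t))) := by
      refine tendsto_integral_of_dominated_convergence (fun _ => 1) (fun k => ?_)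
        (integrable_const _) (fun k => ae_of_all _ fun x => ?_) ?_
      · exact (((hG.comp (measurable_update_const i t)).min
          measurable_const).div_const _).aestronglyMeasurable
      · have hp : (0 : ℝ) < 1 / ((k : ℝ) + 2) := by positivity
        rw [Real.norm_of_nonneg (div_nonneg (le_min (h0 _) hp.le) hp.le)]
        exact (div_le_one hp).2 (min_le_right _ _)
      · filter_upwards [ae_restrict_mem (measurableSet_cube n)] with x hx
        have hc := update_mem_cube hx i htI
        rcases (h0 (Function.update x i t)).lt_or_eq with hpos | hzero
        · rw [Set.indicator_of_mem (show _ ∈ {x | 0 < G x} ∩ cube n from ⟨hpos, hc⟩)]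
          refine tendsto_const_nhds.congr' ?_
          obtain ⟨K, hK⟩ := exists_nat_gt (1 / G (Function.update x i t))
          filter_upwards [Filter.eventually_ge_atTop K] with k hk
          have hp : (0 : ℝ) < 1 / ((k : ℝ) + 2) := by positivity
          have hkK : (K : ℝ) ≤ k := by exact_mod_cast hk
          rw [min_eq_right, div_self hp.ne']
          · rfl
          · rw [div_le_iff₀ (by positivity)]
            rw [div_lt_iff₀ hpos] at hK
            nlinarith
        · rw [Set.indicator_of_notMem (fun h => h.1.ne hzero)]
          refine tendsto_const_nhds.congr fun k => ?_
          rw [← hzero, min_eq_left (by positivity), zero_div]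
    simp only [← ht] at hlim
    exact tendsto_nhds_unique tendsto_const_nhds hlim

/-- Measurable functions with values in `[0,1]` that vanish off the cube and have the marginals
`q`, tested against measurable sets. -/
structure IsFeasible (n : ℕ) (q : Fin n → ℝ → ℝ) (f : (Fin n → ℝ) → ℝ) : Prop where
  measurable : Measurable f
  nonneg : ∀ x, 0 ≤ f x
  le_indicator : ∀ x, f x ≤ (cube n).indicator 1 x
  marginal : ∀ i, ∀ S : Set ℝ, MeasurableSet S →
    ∫ x in {x | x i ∈ S} ∩ cube n, f x = ∫ t in S ∩ Set.Icc (0 : ℝ) 1, q i t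

namespace IsFeasible

variable {n : ℕ} {q : Fin n → ℝ → ℝ} {f : (Fin n → ℝ) → ℝ}

lemma le_one (hf : IsFeasible n q f) (x : Fin n → ℝ) : f x ≤ 1 :=
  (hf.le_indicator x).trans (Set.indicator_le_self' (fun _ _ => zero_le_one) x)

lemma eq_zero (hf : IsFeasible n q f) {x : Fin n → ℝ} (hx : x ∉ cube n) : f x = 0 :=
  le_antisymm (by simpa [hx] using hf.le_indicator x) (hf.nonneg x)

lemma abs_le (hf : IsFeasible n q f) (x : Fin n → ℝ) : |f x| ≤ 1 := by
  rw [abs_of_nonneg (hf.nonneg x)]; exact hf.le_one x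

lemma integrableOn (hf : IsFeasible n q f) : IntegrableOn f (cube n) :=
  integrableOn_cube_of_bound hf.measurable 1 hf.abs_le

lemma ae_marginal (hf : IsFeasible n q f) (hq : ∀ i, MonoLC (q i)) (i : Fin n) :
    ∀ᵐ t ∂((volume : Measure ℝ).restrict (Set.Icc 0 1)),
      ∫ x in cube n, f (Function.update x i t) = q i t := by
  refine Integrable.ae_eq_of_forall_setIntegral_eq _ _ ?_ ?_ fun S hS _ => ?_
  · refine Integrable.of_bound (measurable_marginal i hf.measurable).aestronglyMeasurable 1
      (ae_of_all _ fun t => ?_)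
    have := marginal_mem_Icc i hf.nonneg hf.le_one t
    rw [Real.norm_of_nonneg this.1]
    exact this.2
  · exact (hq i).1.integrableOn_isCompact isCompact_Icc
  · rw [Measure.restrict_restrict hS, ← hf.marginal i S hS, setIntegral_slab_eq i hf.integrableOn hS]

lemma memLp (hf : IsFeasible n q f) : MemLp f 2 volume := by
  have h : MemLp ((cube n).indicator fun _ => (1 : ℝ)) 2 volume :=
    memLp_indicator_const 2 (measurableSet_cube n) 1 (Or.inr (volume_cube_ne_top n))
  refine h.of_le hf.measurable.aestronglyMeasurable (ae_of_all _ fun x => ?_)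
  rw [Real.norm_of_nonneg (hf.nonneg x)]
  exact (hf.le_indicator x).trans (Real.le_norm_self _)

end IsFeasible

lemma exists_isFeasible {n : ℕ} {q : Fin n → ℝ → ℝ} {f : (Fin n → ℝ) → ℝ}
    (hf : RationalizesN n f q) : ∃ g, IsFeasible n q g := by
  obtain ⟨hm, h01, hq⟩ := hf
  set g : (Fin n → ℝ) → ℝ := (cube n).indicator fun x => max 0 (min (hm.mk f x) 1) with hg
  have hgm : Measurable g :=
    (measurable_const.max (hm.measurable_mk.min measurable_const)).indicator (measurableSet_cube n)
  have hg0 : ∀ x, 0 ≤ g x := fun x => Set.indicator_nonneg (fun _ _ => le_max_left _ _) x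
  have hg1 : ∀ x, g x ≤ (cube n).indicator 1 x := fun x =>
    Set.indicator_le_indicator (max_le zero_le_one (min_le_right _ _))
  have hg1' : ∀ x, |g x| ≤ 1 := fun x => by
    rw [abs_of_nonneg (hg0 x)]
    exact (hg1 x).trans (Set.indicator_le_self' (fun _ _ => zero_le_one) x)
  have hfg : ∀ᵐ x ∂(volume.restrict (cube n)), f x = g x := by
    filter_upwards [hm.ae_eq_mk, ae_restrict_mem (measurableSet_cube n)] with x hx hxc
    rw [hg, Set.indicator_of_mem hxc, ← hx, min_eq_left (h01 x hxc).2, max_eq_right (h01 x hxc).1]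
  refine ⟨g, hgm, hg0, hg1, fun i S hS => ?_⟩
  rw [setIntegral_slab_eq i (integrableOn_cube_of_bound hgm 1 hg1') hS,
    ← Measure.restrict_restrict hS]
  refine integral_congr_ae (ae_restrict_of_ae ?_)
  filter_upwards [hq i, ae_ae_update i hfg] with t h1 h2
  rw [h1]
  exact integral_congr_ae (by filter_upwards [h2] with x hx using hx.symm)

/-- There is a feasible function of minimal `L²` norm, characterized by the variational
inequality. -/
lemma exists_isFeasible_min {n : ℕ} {q : Fin n → ℝ → ℝ} (h : ∃ f, IsFeasible n q f) :
    ∃ f, IsFeasible n q f ∧ ∀ w, IsFeasible n q w → 0 ≤ ∫ x, f x * (w x - f x) := by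
  set u : Lp ℝ 2 (volume : Measure (Fin n → ℝ)) :=
    indicatorConstLp 2 (measurableSet_cube n) (volume_cube_ne_top n) 1
  have hfin : ∀ (i : Fin n) (S : Set ℝ), volume ({x : Fin n → ℝ | x i ∈ S} ∩ cube n) ≠ ⊤ :=
    fun i S => measure_ne_top_of_subset Set.inter_subset_right (volume_cube_ne_top n)
  have hE : ∀ (i : Fin n) (S : Set ℝ), MeasurableSet S →
      MeasurableSet ({x : Fin n → ℝ | x i ∈ S} ∩ cube n) := fun i S hS =>
    (measurable_pi_apply i hS).inter (measurableSet_cube n)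
  set K : Set (Lp ℝ 2 (volume : Measure (Fin n → ℝ))) := Set.Icc 0 u ∩
    {g | ∀ (i : Fin n) (S : Set ℝ) (hS : MeasurableSet S),
      inner ℝ (indicatorConstLp 2 (hE i S hS) (hfin i S) (1 : ℝ)) g =
        ∫ t in S ∩ Set.Icc (0 : ℝ) 1, q i t} with hK
  have hclosed : IsClosed K := by
    refine isClosed_Icc.inter ?_
    simp only [Set.ofPred_forall]
    refine isClosed_iInter fun i => isClosed_iInter fun S => isClosed_iInter fun hS => ?_
    exact isClosed_eq (by fun_prop) continuous_const
  have hconv : Convex ℝ K := by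
    have : PosSMulMono ℝ (Lp ℝ 2 (volume : Measure (Fin n → ℝ))) := by
      refine ⟨fun a ha g g' hg => ?_⟩
      rw [← Lp.coeFn_le] at hg ⊢
      filter_upwards [hg, Lp.coeFn_smul a g, Lp.coeFn_smul a g'] with x h1 h2 h3
      rw [h2, h3]
      exact mul_le_mul_of_nonneg_left h1 ha
    refine (convex_Icc 0 u).inter ?_
    intro g hg g' hg' a b _ _ hab i S hS
    rw [inner_add_right, inner_smul_right, inner_smul_right, hg i S hS, hg' i S hS, ← add_mul, hab,
      one_mul]
  have hmem : ∀ {w} (hw : IsFeasible n q w), hw.memLp.toLp w ∈ K := by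
    intro w hw
    have hco := hw.memLp.coeFn_toLp
    refine ⟨⟨?_, ?_⟩, fun i S hS => ?_⟩
    · rw [← Lp.coeFn_le]
      filter_upwards [hco, Lp.coeFn_zero ℝ 2 (volume : Measure (Fin n → ℝ))] with x h1 h2
      rw [h1, h2]
      exact hw.nonneg x
    · rw [← Lp.coeFn_le]
      filter_upwards [hco, indicatorConstLp_coeFn (p := 2) (hs := measurableSet_cube n)
        (hμs := volume_cube_ne_top n) (c := (1 : ℝ))] with x h1 h2
      rw [h1, h2]
      exact hw.le_indicator x
    · rw [L2.inner_indicatorConstLp_one, ← hw.marginal i S hS]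
      exact integral_congr_ae (ae_restrict_of_ae hco)
  obtain ⟨f₀, hf₀⟩ := h
  obtain ⟨v, hvK, hv⟩ := exists_norm_eq_iInf_of_complete_convex ⟨_, hmem hf₀⟩
    hclosed.isComplete hconv 0
  rw [norm_eq_iInf_iff_real_inner_le_zero hconv hvK] at hv
  set f : (Fin n → ℝ) → ℝ := (cube n).indicator fun x => max 0 (min (v x) 1) with hfdef
  have hvm : Measurable v := (Lp.stronglyMeasurable v).measurable
  have hfv : v =ᵐ[volume] f := by
    filter_upwards [(Lp.coeFn_le _ _).2 hvK.1.1, (Lp.coeFn_le _ _).2 hvK.1.2,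
      Lp.coeFn_zero ℝ 2 (volume : Measure (Fin n → ℝ)),
      indicatorConstLp_coeFn (p := 2) (hs := measurableSet_cube n)
        (hμs := volume_cube_ne_top n) (c := (1 : ℝ))] with x h1 h2 h3 h4
    rw [h3] at h1
    rw [h4] at h2
    simp only [Pi.zero_apply] at h1
    by_cases hx : x ∈ cube n
    · simp only [Set.indicator_of_mem hx] at h2
      rw [hfdef, Set.indicator_of_mem hx, min_eq_left h2, max_eq_right h1]
    · simp only [Set.indicator_of_notMem hx] at h2
      rw [hfdef, Set.indicator_of_notMem hx]
      exact le_antisymm h2 h1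
  have hf : IsFeasible n q f := by
    refine ⟨(measurable_const.max (hvm.min measurable_const)).indicator (measurableSet_cube n),
      fun x => Set.indicator_nonneg (fun _ _ => le_max_left _ _) x,
      fun x => Set.indicator_le_indicator (max_le zero_le_one (min_le_right _ _)), fun i S hS => ?_⟩
    rw [← hvK.2 i S hS, L2.inner_indicatorConstLp_one]
    exact integral_congr_ae (ae_restrict_of_ae hfv.symm)
  refine ⟨f, hf, fun w hw => ?_⟩
  have hle := hv _ (hmem hw)
  rw [zero_sub, inner_neg_left, neg_nonpos, L2.inner_def] at hle
  refine hle.trans_eq (integral_congr_ae ?_)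
  filter_upwards [hfv, Lp.coeFn_sub (hw.memLp.toLp w) v, hw.memLp.coeFn_toLp] with x h1 h2 h3
  rw [h2, Pi.sub_apply, h3, h1]
  simp [mul_comm]

lemma integrable_of_bound_of_eq_zero {n : ℕ} {f : (Fin n → ℝ) → ℝ} (hf : Measurable f) (C : ℝ)
    (hC : ∀ x, |f x| ≤ C) (h0 : ∀ x, x ∉ cube n → f x = 0) : Integrable f := by
  rw [← integrableOn_iff_integrable_of_support_subset (s := cube n)]
  · exact integrableOn_cube_of_bound hf C hC
  · intro x hx
    by_contra h
    exact hx (h0 x h)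

lemma update_add_single {n : ℕ} (x : Fin n → ℝ) (i : Fin n) (t c : ℝ) :
    Function.update x i t + Pi.single i c = Function.update x i (t + c) := by
  ext j
  by_cases h : j = i
  · subst h; simp
  · simp [h]

/-- A feasible function of minimal norm is almost everywhere nondecreasing in each coordinate: if
not, moving mass between `x` and `x + c eᵢ` would decrease the norm and keep all marginals. -/
lemma IsFeasible.ae_le_add_single {n : ℕ} {q : Fin n → ℝ → ℝ} {f : (Fin n → ℝ) → ℝ}
    (hf : IsFeasible n q f) (hq : ∀ i, MonoLC (q i))
    (hmin : ∀ w, IsFeasible n q w → 0 ≤ ∫ x, f x * (w x - f x)) (i : Fin n) {c : ℝ}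
    (hc : 0 ≤ c) :
    ∀ᵐ x, x ∈ cube n → x + Pi.single i c ∈ cube n → f x ≤ f (x + Pi.single i c) := by
  set e : Fin n → ℝ := Pi.single i c with he
  set D : Set (Fin n → ℝ) := {x | x ∈ cube n ∧ x + e ∈ cube n} with hD
  have hDm : MeasurableSet D :=
    (measurableSet_cube n).inter (measurable_id.add_const e (measurableSet_cube n))
  set g : (Fin n → ℝ) → ℝ := D.indicator fun x => f (x + e) - f x with hg
  have hgm : Measurable g :=
    ((hf.measurable.comp (measurable_id.add_const e)).sub hf.measurable).indicator hDm
  have hgD : ∀ {x}, x ∈ D → g x = f (x + e) - f x := fun hx => Set.indicator_of_mem hx _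
  have hgD' : ∀ {x}, x ∉ D → g x = 0 := fun hx => Set.indicator_of_notMem hx _
  have hg1 : ∀ x, |g x| ≤ 1 := by
    intro x
    by_cases hx : x ∈ D
    · rw [hgD hx, _root_.abs_le]
      constructor <;> linarith [hf.nonneg x, hf.nonneg (x + e), hf.le_one x, hf.le_one (x + e)]
    · simp [hgD' hx]
  set gp : (Fin n → ℝ) → ℝ := fun x => max (g x) 0 with hgp
  set gm : (Fin n → ℝ) → ℝ := fun x => max (-g x) 0 with hgm'
  have gp_meas : Measurable gp := hgm.max measurable_const
  have gm_meas : Measurable gm := hgm.neg.max measurable_const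
  have gp0 : ∀ x, 0 ≤ gp x := fun x => le_max_right _ _
  have gm0 : ∀ x, 0 ≤ gm x := fun x => le_max_right _ _
  have gp1 : ∀ x, gp x ≤ 1 := fun x => max_le (_root_.abs_le.1 (hg1 x)).2 zero_le_one
  have gm1 : ∀ x, gm x ≤ 1 := fun x =>
    max_le (by linarith [(_root_.abs_le.1 (hg1 x)).1]) zero_le_one
  have hsub : ∀ x, gp x - gm x = g x := fun x => by
    simp only [hgp, hgm']
    rcases le_total (g x) 0 with h | h
    · rw [max_eq_right h, max_eq_left (by linarith)]; ring
    · rw [max_eq_left h, max_eq_right (by linarith)]; ring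
  have hmul : ∀ x, gp x * gm x = 0 := fun x => by
    simp only [hgp, hgm']
    rcases le_total (g x) 0 with h | h
    · rw [max_eq_right h, zero_mul]
    · rw [max_eq_right (a := -g x) (by linarith), mul_zero]
  set P : ℝ → ℝ := fun t => ∫ x in cube n, gp (Function.update x i t) with hP
  set N : ℝ → ℝ := fun t => ∫ x in cube n, gm (Function.update x i t) with hN
  have P01 : ∀ t, P t ∈ Set.Icc (0 : ℝ) 1 := marginal_mem_Icc i gp0 gp1
  have N01 : ∀ t, N t ∈ Set.Icc (0 : ℝ) 1 := marginal_mem_Icc i gm0 gm1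
  have gp_int : ∀ t, IntegrableOn (fun x => gp (Function.update x i t)) (cube n) := fun t =>
    integrableOn_cube_of_bound (gp_meas.comp (measurable_update_const i t)) 1
      fun x => by rw [abs_of_nonneg (gp0 _)]; exact gp1 _
  have gm_int : ∀ t, IntegrableOn (fun x => gm (Function.update x i t)) (cube n) := fun t =>
    integrableOn_cube_of_bound (gm_meas.comp (measurable_update_const i t)) 1
      fun x => by rw [abs_of_nonneg (gm0 _)]; exact gm1 _
  set ψ : (Fin n → ℝ) → ℝ := fun x => N (x i) * gp x - P (x i) * gm x with hψ
  have Pm : Measurable fun x : Fin n → ℝ => P (x i) :=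
    (measurable_marginal i gp_meas).comp (measurable_pi_apply i)
  have Nm : Measurable fun x : Fin n → ℝ => N (x i) :=
    (measurable_marginal i gm_meas).comp (measurable_pi_apply i)
  have ψ_meas : Measurable ψ := (Nm.mul gp_meas).sub (Pm.mul gm_meas)
  have ψ_meas' : Measurable fun x => ψ (x - e) := ψ_meas.comp (measurable_id.sub_const e)
  have ψD : ∀ {x}, x ∉ D → ψ x = 0 := fun {x} hx => by simp [hψ, hgp, hgm', hgD' hx]
  have ψ_pos : ∀ {x}, 0 ≤ g x → 0 ≤ ψ x ∧ ψ x ≤ g x := by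
    intro x hx
    have h1 : gm x = 0 := max_eq_right (by linarith)
    have h2 : gp x = g x := max_eq_left hx
    simp only [hψ, h1, h2, mul_zero, sub_zero]
    exact ⟨mul_nonneg (N01 _).1 hx, mul_le_of_le_one_left hx (N01 _).2⟩
  have ψ_neg : ∀ {x}, g x ≤ 0 → g x ≤ ψ x ∧ ψ x ≤ 0 := by
    intro x hx
    have h1 : gm x = -g x := max_eq_left (by linarith)
    have h2 : gp x = 0 := max_eq_right hx
    simp only [hψ, h1, h2, mul_zero, zero_sub]
    constructor <;> nlinarith [(P01 (x i)).1, (P01 (x i)).2]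
  have ψ1 : ∀ x, |ψ x| ≤ 1 := by
    intro x
    have := _root_.abs_le.1 (hg1 x)
    rw [_root_.abs_le]
    rcases le_total 0 (g x) with h | h
    · have := ψ_pos h
      constructor <;> linarith
    · have := ψ_neg h
      constructor <;> linarith
  have hplus : ∀ x, 0 ≤ f x + ψ x ∧ f x + ψ x ≤ (cube n).indicator 1 x := by
    intro x
    by_cases hx : x ∈ D
    · rw [Set.indicator_of_mem hx.1, Pi.one_apply]
      have h := hgD hx
      have := hf.nonneg x
      have := hf.nonneg (x + e)
      have := hf.le_one x
      have := hf.le_one (x + e)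
      rcases le_total 0 (g x) with hs | hs
      · have := ψ_pos hs
        constructor <;> linarith
      · have := ψ_neg hs
        constructor <;> linarith
    · rw [ψD hx, add_zero]
      exact ⟨hf.nonneg x, hf.le_indicator x⟩
  have hminus : ∀ x, 0 ≤ f x - ψ (x - e) ∧ f x - ψ (x - e) ≤ (cube n).indicator 1 x := by
    intro x
    by_cases hx : x - e ∈ D
    · have h := hgD hx
      have hxc := hx.2
      rw [sub_add_cancel] at h hxc
      rw [Set.indicator_of_mem hxc, Pi.one_apply]
      have := hf.nonneg x
      have := hf.nonneg (x - e)
      have := hf.le_one x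
      have := hf.le_one (x - e)
      rcases le_total 0 (g (x - e)) with hs | hs
      · have := ψ_pos hs
        constructor <;> linarith
      · have := ψ_neg hs
        constructor <;> linarith
    · rw [ψD hx, sub_zero]
      exact ⟨hf.nonneg x, hf.le_indicator x⟩
  have hslab : ∀ T : Set ℝ, MeasurableSet T → ∫ x in {x | x i ∈ T} ∩ cube n, ψ x = 0 := by
    intro T hT
    rw [setIntegral_slab_eq i (integrableOn_cube_of_bound ψ_meas 1 ψ1) hT]
    refine integral_eq_zero_of_ae (ae_of_all _ fun t => ?_)
    simp only [hψ, Function.update_self, Pi.zero_apply]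
    rw [integral_sub ((gp_int t).const_mul _) ((gm_int t).const_mul _), integral_const_mul,
      integral_const_mul]
    change N t * P t - P t * N t = 0
    ring
  have hshift : ∀ (j : Fin n) (S : Set ℝ), MeasurableSet S →
      ∫ x in {x | x j ∈ S} ∩ cube n, ψ (x - e) =
        ∫ x in {x | x j ∈ (· + e j) ⁻¹' S} ∩ cube n, ψ x := by
    intro j S hS
    have hS' : MeasurableSet ((· + e j) ⁻¹' S) := measurable_id.add_const (e j) hS
    have hE : MeasurableSet {x : Fin n → ℝ | x j ∈ S} := measurable_pi_apply j hS
    have hE' : MeasurableSet {x : Fin n → ℝ | x j ∈ (· + e j) ⁻¹' S} := measurable_pi_apply j hS'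
    rw [← integral_indicator (hE.inter (measurableSet_cube n)),
      ← integral_indicator (hE'.inter (measurableSet_cube n)),
      ← integral_sub_right_eq_self (({x | x j ∈ (· + e j) ⁻¹' S} ∩ cube n).indicator ψ) e]
    congr 1
    ext x
    by_cases hx : x - e ∈ D
    · have h2 := hx.2
      rw [sub_add_cancel] at h2
      have h1 := hx.1
      by_cases hxS : x j ∈ S <;> simp [Set.indicator, h1, h2, hxS]
    · simp [Set.indicator, ψD hx]
  have hw : IsFeasible n q fun x => f x + (ψ x - ψ (x - e)) / 2 := by
    refine ⟨hf.measurable.add ((ψ_meas.sub ψ_meas').div_const 2), fun x => ?_, fun x => ?_,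
      fun j S hS => ?_⟩
    · linarith [(hplus x).1, (hminus x).1]
    · linarith [(hplus x).2, (hminus x).2]
    · have hi : ∀ {h : (Fin n → ℝ) → ℝ}, IntegrableOn h (cube n) →
          IntegrableOn h ({x | x j ∈ S} ∩ cube n) := fun h => h.mono_set Set.inter_subset_right
      have i1 := hi (integrableOn_cube_of_bound ψ_meas 1 ψ1)
      have i2 := hi (integrableOn_cube_of_bound ψ_meas' 1 fun x => ψ1 _)
      have i3 : IntegrableOn (fun x => (ψ x - ψ (x - e)) / 2) ({x | x j ∈ S} ∩ cube n) :=
        (i1.sub i2).div_const 2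
      rw [integral_add (hi hf.integrableOn) i3, integral_div,
        integral_sub i1 i2, hshift j S hS, hf.marginal j S hS]
      have hzero : ∫ x in {x | x j ∈ S} ∩ cube n, ψ x =
          ∫ x in {x | x j ∈ (· + e j) ⁻¹' S} ∩ cube n, ψ x := by
        by_cases hj : j = i
        · subst hj
          have hS' : MeasurableSet ((· + e j) ⁻¹' S) := measurable_id.add_const (e j) hS
          rw [hslab S hS, hslab _ hS']
        · simp [he, hj]
      rw [hzero, sub_self, zero_div, add_zero]
  have hfψ : Integrable fun x => f x * ψ x :=
    integrable_of_bound_of_eq_zero (hf.measurable.mul ψ_meas) 1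
      (fun x => by rw [abs_mul]; exact mul_le_one₀ (hf.abs_le x) (abs_nonneg _) (ψ1 x))
      fun x hx => by rw [hf.eq_zero hx, zero_mul]
  have hfψ₁ : Integrable fun x => f x * ψ (x - e) :=
    integrable_of_bound_of_eq_zero (hf.measurable.mul ψ_meas') 1
      (fun x => by rw [abs_mul]; exact mul_le_one₀ (hf.abs_le x) (abs_nonneg _) (ψ1 _))
      fun x hx => by rw [hf.eq_zero hx, zero_mul]
  have hfψ₂ : Integrable fun x => f (x + e) * ψ x :=
    integrable_of_bound_of_eq_zero
      ((hf.measurable.comp (measurable_id.add_const e)).mul ψ_meas) 1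
      (fun x => by rw [abs_mul]; exact mul_le_one₀ (hf.abs_le _) (abs_nonneg _) (ψ1 _))
      fun x hx => by rw [ψD fun h => hx h.1, mul_zero]
  have hfo : ∫ x, (f (x + e) * ψ x - f x * ψ x) ≤ 0 := by
    have h := hmin _ hw
    have h2 : ∫ x, f x * ψ (x - e) = ∫ x, f (x + e) * ψ x := by
      rw [← integral_add_right_eq_self _ e]
      simp only [add_sub_cancel_right]
    have h3 : ∫ x, f x * (f x + (ψ x - ψ (x - e)) / 2 - f x) =
        ((∫ x, f x * ψ x) - ∫ x, f (x + e) * ψ x) / 2 := by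
      rw [← h2, ← integral_sub hfψ hfψ₁, ← integral_div]
      congr 1
      ext x
      ring
    rw [h3] at h
    rw [integral_sub hfψ₂ hfψ]
    linarith
  have hquad : ∀ x, f (x + e) * ψ x - f x * ψ x =
      N (x i) * gp x ^ 2 + P (x i) * gm x ^ 2 := by
    intro x
    by_cases hx : x ∈ D
    · have h1 : f (x + e) * ψ x - f x * ψ x = (gp x - gm x) * ψ x := by
        rw [hsub, hgD hx]; ring
      rw [h1]
      simp only [hψ]
      linear_combination (-(P (x i)) - N (x i)) * hmul x
    · simp [ψD hx, hgp, hgm', hgD' hx]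
  have hquad0 : ∀ x, 0 ≤ f (x + e) * ψ x - f x * ψ x := fun x => by
    rw [hquad]
    exact add_nonneg (mul_nonneg (N01 _).1 (sq_nonneg _)) (mul_nonneg (P01 _).1 (sq_nonneg _))
  have hae := (integral_eq_zero_iff_of_nonneg hquad0 (hfψ₂.sub hfψ)).1
    (le_antisymm hfo (integral_nonneg hquad0))
  have hPgm : ∀ᵐ x ∂(volume.restrict (cube n)), P (x i) * gm x = 0 := by
    refine ae_restrict_of_ae ?_
    filter_upwards [hae] with x hx
    rw [hquad, Pi.zero_apply] at hx
    have h1 := mul_nonneg (N01 (x i)).1 (sq_nonneg (gp x))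
    have h2 := mul_nonneg (P01 (x i)).1 (sq_nonneg (gm x))
    have h3 : P (x i) * gm x ^ 2 = 0 := by linarith
    rcases mul_eq_zero.1 h3 with h | h
    · rw [h, zero_mul]
    · rw [pow_eq_zero_iff two_ne_zero] at h
      rw [h, mul_zero]
  have hmarg := hf.ae_marginal hq i
  have hmarg' : ∀ᵐ t ∂((volume : Measure ℝ).restrict (Set.Icc 0 1)), t + c ∈ Set.Icc (0 : ℝ) 1 →
      ∫ x in cube n, f (Function.update x i (t + c)) = q i (t + c) := by
    refine ae_restrict_of_ae ?_
    rw [ae_restrict_iff' measurableSet_Icc] at hmarg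
    exact (measurePreserving_add_right volume c).quasiMeasurePreserving.ae hmarg
  have hNle : ∀ᵐ t ∂((volume : Measure ℝ).restrict (Set.Icc 0 1)), N t ≤ P t := by
    filter_upwards [hmarg, hmarg', ae_restrict_mem measurableSet_Icc] with t h1 h2 ht
    rw [← sub_nonneg, ← integral_sub (gp_int t) (gm_int t)]
    simp only [hsub]
    by_cases htc : t + c ≤ 1
    · have htc' : t + c ∈ Set.Icc (0 : ℝ) 1 := ⟨by linarith [ht.1], htc⟩
      have hfi : ∀ s, IntegrableOn (fun x => f (Function.update x i s)) (cube n) := fun s =>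
        integrableOn_cube_of_bound (hf.measurable.comp (measurable_update_const i s)) 1
          fun x => hf.abs_le _
      have h3 : ∫ x in cube n, g (Function.update x i t) =
          ∫ x in cube n, (f (Function.update x i (t + c)) - f (Function.update x i t)) := by
        refine setIntegral_congr_fun (measurableSet_cube n) fun x hx => ?_
        have hxD : Function.update x i t ∈ D :=
          ⟨update_mem_cube hx i ht, by
            rw [he, update_add_single]; exact update_mem_cube hx i htc'⟩
        simp only [hgD hxD]
        rw [he, update_add_single]
      rw [h3, integral_sub (hfi _) (hfi _), h1, h2 htc', sub_nonneg]
      exact (hq i).1 ht htc' (by linarith)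
    · refine (setIntegral_eq_zero_of_forall_eq_zero fun x _ => hgD' fun h => ?_).ge
      have h3 := h.2
      rw [he, update_add_single, mem_cube] at h3
      exact htc (by simpa using (h3 i).2)
  have hN0 : ∀ᵐ t ∂((volume : Measure ℝ).restrict (Set.Icc 0 1)), N t = 0 := by
    filter_upwards [hNle, ae_ae_update i hPgm] with t h1 h2
    have h3 : P t * N t = 0 := by
      rw [hN, ← integral_const_mul]
      refine integral_eq_zero_of_ae ?_
      filter_upwards [h2] with x hx
      simpa using hx
    rcases mul_eq_zero.1 h3 with h | h
    · exact le_antisymm (h1.trans_eq h) (N01 t).1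
    · exact h
  have hgi : IntegrableOn gm (cube n) := integrableOn_cube_of_bound gm_meas 1
    fun x => by rw [abs_of_nonneg (gm0 _)]; exact gm1 _
  have hgm_int : ∫ x in cube n, gm x = 0 := by
    rw [integral_cube_eq i hgi]
    exact integral_eq_zero_of_ae hN0
  have hgm_ae := (integral_eq_zero_iff_of_nonneg gm0 hgi).1 hgm_int
  rw [Filter.EventuallyEq, ae_restrict_iff' (measurableSet_cube n)] at hgm_ae
  filter_upwards [hgm_ae] with x hx hxc hxe
  have h1 : -g x ≤ 0 := (le_max_left _ _).trans_eq (hx hxc)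
  rw [hgD ⟨hxc, hxe⟩] at h1
  linarith

lemma ae_le_add_of_ae_le_add_single {n : ℕ} {F : (Fin n → ℝ) → ℝ}
    (h : ∀ i, ∀ c : ℝ, 0 ≤ c → ∀ᵐ x, F x ≤ F (x + Pi.single i c)) {v : Fin n → ℝ} (hv : 0 ≤ v) :
    ∀ᵐ x, F x ≤ F (x + v) := by
  rw [← Finset.univ_sum_single v]
  refine Finset.sum_induction _ (fun v => ∀ᵐ x, F x ≤ F (x + v)) (fun v w hv hw => ?_)
    (by simp) fun i _ => h i _ (hv i)
  filter_upwards [hv, (measurePreserving_add_right volume v).quasiMeasurePreserving.ae hw]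
    with x h1 h2
  rw [← add_assoc]
  exact h1.trans h2

/-- A bounded function which is almost everywhere nondecreasing along every translation agrees
almost everywhere with a monotone function. -/
lemma exists_monotone_ae_eq {n : ℕ} {F : (Fin n → ℝ) → ℝ} (hF : Measurable F) (h0 : ∀ x, 0 ≤ F x)
    (h1 : ∀ x, F x ≤ 1) (h : ∀ v, 0 ≤ v → ∀ᵐ x, F x ≤ F (x + v)) :
    ∃ G : (Fin n → ℝ) → ℝ, Measurable G ∧ Monotone G ∧ (∀ x, 0 ≤ G x) ∧ (∀ x, G x ≤ 1) ∧
      F =ᵐ[volume] G := by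
  set δ : ℕ → ℝ := fun k => 1 / ((k : ℝ) + 1)
  have hδ : Filter.Tendsto δ Filter.atTop (nhdsWithin 0 (Set.Ioi 0)) :=
    tendsto_nhdsWithin_iff.2 ⟨tendsto_one_div_add_atTop_nhds_zero_nat,
      Filter.Eventually.of_forall fun k => show (0 : ℝ) < 1 / ((k : ℝ) + 1) by positivity⟩
  set A : ℕ → (Fin n → ℝ) → ℝ := fun k x => ⨍ y in Metric.closedBall 0 (δ k), F (x + y) with hA
  have hfin : ∀ k, IsFiniteMeasure
      ((volume : Measure (Fin n → ℝ)).restrict (Metric.closedBall 0 (δ k))) := fun k =>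
    ⟨by simpa using measure_closedBall_lt_top⟩
  have hint : ∀ k x, IntegrableOn (fun y => F (x + y)) (Metric.closedBall 0 (δ k)) := fun k x =>
    Integrable.of_bound (hF.comp (measurable_const.add measurable_id)).aestronglyMeasurable 1
      (ae_of_all _ fun y => by rw [Real.norm_of_nonneg (h0 _)]; exact h1 _)
  have hAm : ∀ k, Measurable (A k) := by
    intro k
    simp only [hA, setAverage_eq, smul_eq_mul]
    have hs : StronglyMeasurable (Function.uncurry fun x y : Fin n → ℝ => F (x + y)) :=
      (hF.comp measurable_add).stronglyMeasurable
    exact ((hs.integral_prod_right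
      (ν := volume.restrict (Metric.closedBall 0 (δ k)))).measurable.const_mul _)
  have hA0 : ∀ k x, 0 ≤ A k x := fun k x => by
    simp only [hA, setAverage_eq]
    exact mul_nonneg (inv_nonneg.2 measureReal_nonneg) (integral_nonneg fun y => h0 _)
  have hA1 : ∀ k x, A k x ≤ 1 := fun k x => by
    simp only [hA, setAverage_eq]
    have hle : ∫ y in Metric.closedBall 0 (δ k), F (x + y) ≤
        volume.real (Metric.closedBall (0 : Fin n → ℝ) (δ k)) := by
      have := integral_mono (hint k x) (integrable_const (1 : ℝ)) fun y => h1 (x + y)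
      simpa using this
    rw [smul_eq_mul, inv_mul_eq_div]
    exact div_le_one_of_le₀ hle measureReal_nonneg
  have hAmono : ∀ k, Monotone (A k) := by
    intro k x x' hxx'
    simp only [hA, setAverage_eq]
    refine mul_le_mul_of_nonneg_left ?_ (inv_nonneg.2 measureReal_nonneg)
    refine integral_mono_ae (hint k x) (hint k x') (ae_restrict_of_ae ?_)
    filter_upwards [(measurePreserving_add_left volume x).quasiMeasurePreserving.ae
      (h (x' - x) (sub_nonneg.2 hxx'))] with y hy
    rwa [show x + y + (x' - x) = x' + y by abel] at hy
  have hbdd : ∀ x, Filter.IsBoundedUnder (· ≤ ·) Filter.atTop fun k => A k x := fun x =>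
    Filter.isBoundedUnder_of ⟨1, fun k => hA1 k x⟩
  have hcob : ∀ x, Filter.IsCoboundedUnder (· ≤ ·) Filter.atTop fun k => A k x := fun x =>
    (Filter.isBoundedUnder_of (r := (· ≥ ·)) ⟨0, fun k => hA0 k x⟩).isCoboundedUnder_le
  refine ⟨fun x => Filter.limsup (fun k => A k x) Filter.atTop, Measurable.limsup hAm,
    fun x x' hxx' => Filter.limsup_le_limsup (Filter.Eventually.of_forall fun k => hAmono k hxx')
      (hcob x) (hbdd x'), fun x => ?_, fun x => ?_, ?_⟩
  · exact Filter.le_limsup_of_frequently_le (Filter.Frequently.of_forall fun k => hA0 k x) (hbdd x)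
  · exact Filter.limsup_le_of_le (hcob x) (Filter.Eventually.of_forall fun k => hA1 k x)
  · have hloc : LocallyIntegrable F volume := by
      have h1' : MemLp F ⊤ volume := memLp_top_of_bound hF.aestronglyMeasurable 1
        (ae_of_all _ fun y => by rw [Real.norm_of_nonneg (h0 _)]; exact h1 _)
      exact h1'.locallyIntegrable le_top
    filter_upwards [IsUnifLocDoublingMeasure.ae_tendsto_average volume hloc 1] with x hx
    have ht := hx (fun _ => x) δ hδ (Filter.Eventually.of_forall fun k => by
      refine Metric.mem_closedBall_self ?_
      show (0 : ℝ) ≤ 1 * (1 / ((k : ℝ) + 1))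
      positivity)
    have heq : ∀ k, ⨍ y in Metric.closedBall x (δ k), F y = A k x := by
      intro k
      simp only [hA, setAverage_eq]
      congr 1
      · simp only [measureReal_def]
        rw [Measure.addHaar_closedBall_center]
      · rw [← (measurePreserving_add_left volume x).setIntegral_preimage_emb
          (measurableEmbedding_addLeft x)]
        simp
    simp only [heq] at ht
    exact ht.limsup_eq.symm

/-- Every rationalizable tuple is rationalized by a monotone function. -/
lemma exists_monotone_rationalizesN {n : ℕ} {q : Fin n → ℝ → ℝ} (hq : q ∈ QsetN n) :
    ∃ G : (Fin n → ℝ) → ℝ, Measurable G ∧ Monotone G ∧ (∀ x, 0 ≤ G x) ∧ (∀ x, G x ≤ 1) ∧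
      RationalizesN n G q := by
  obtain ⟨hmono, f₀, hf₀⟩ := hq
  obtain ⟨f, hf, hmin⟩ := exists_isFeasible_min (exists_isFeasible hf₀)
  classical
  set Neg : Set (Fin n → ℝ) := {x | ∃ j, x j < 0}
  set F : (Fin n → ℝ) → ℝ := fun x => if x ∈ Neg then 0 else if x ∈ cube n then f x else 1 with hFd
  have hNeg : MeasurableSet Neg := by
    simp only [Neg, Set.ofPred_exists]
    exact MeasurableSet.iUnion fun j => measurableSet_lt (measurable_pi_apply j) measurable_const
  have hF : Measurable F := Measurable.ite hNeg measurable_const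
    (Measurable.ite (measurableSet_cube n) hf.measurable measurable_const)
  have hF0 : ∀ x, 0 ≤ F x := fun x => by
    simp only [hFd]; split_ifs <;> [exact le_rfl; exact hf.nonneg x; exact zero_le_one]
  have hF1 : ∀ x, F x ≤ 1 := fun x => by
    simp only [hFd]; split_ifs <;> [exact zero_le_one; exact hf.le_one x; exact le_rfl]
  have hFc : ∀ x ∈ cube n, F x = f x := by
    intro x hx
    have hxN : x ∉ Neg := fun ⟨j, hj⟩ => absurd (mem_cube.1 hx j).1 hj.not_ge
    simp only [hFd]
    rw [if_neg hxN, if_pos hx]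
  have hstep : ∀ i, ∀ c : ℝ, 0 ≤ c → ∀ᵐ x, F x ≤ F (x + Pi.single i c) := by
    intro i c hc
    filter_upwards [hf.ae_le_add_single hmono hmin i hc] with x hx
    have hle : x ≤ x + Pi.single i c := le_add_of_nonneg_right (Pi.single_nonneg.2 hc)
    by_cases hxN : x ∈ Neg
    · exact (if_pos hxN : F x = 0).trans_le (hF0 _)
    have hx0 : 0 ≤ x := fun j => not_lt.1 fun hj => hxN ⟨j, hj⟩
    have hyN : x + Pi.single i c ∉ Neg := fun ⟨j, hj⟩ => hj.not_ge ((hx0.trans hle) j)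
    by_cases hy : x + Pi.single i c ∈ cube n
    · have hxc : x ∈ cube n := ⟨hx0, hle.trans hy.2⟩
      rw [hFc x hxc, hFc _ hy]
      exact hx hxc hy
    · have : F (x + Pi.single i c) = 1 := by
        simp only [hFd]
        rw [if_neg hyN, if_neg hy]
      rw [this]
      exact hF1 x
  obtain ⟨G, hG, hGm, hG0, hG1, hFG⟩ := exists_monotone_ae_eq hF hF0 hF1
    fun v hv => ae_le_add_of_ae_le_add_single hstep hv
  refine ⟨G, hG, hGm, hG0, hG1, hG.aemeasurable, fun x _ => ⟨hG0 x, hG1 x⟩, fun i => ?_⟩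
  have hfG : ∀ᵐ x ∂(volume.restrict (cube n)), f x = G x := by
    filter_upwards [ae_restrict_of_ae hFG, ae_restrict_mem (measurableSet_cube n)] with x h1 h2
    rw [← hFc x h2, h1]
  filter_upwards [hf.ae_marginal hmono i, ae_ae_update i hfG] with t h1 h2
  rw [← h1]
  exact integral_congr_ae h2

/-- every extreme point of `𝒬` is rationalized by the indicator
function of some up-set `A ⊆ [0,1]^n`. -/
theorem stmt6 (n : ℕ) (hn : 1 ≤ n) (q : Fin n → ℝ → ℝ)
    (hq : ExtremePtQN n (QsetN n) q) :
    ∃ A : Set (Fin n → ℝ), UpSetIn n A ∧ RationalizesN n (A.indicator 1) q := by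
  obtain ⟨G, hG, hm, h0, h1, hr⟩ := exists_monotone_rationalizesN hq.1
  exact hq.exists_upSetIn hG hm hr h0 h1
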